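/- Let Ω be a compact metric space, let ψ₁,…,ψ_m : Ω → ℝ be continuous, let γ ∈ ℝ^m, and let 𝒫 be the set of Borel probability measures P on Ω with ∫_Ω ψ_i dP ≤ γ_i for every i = 1,…,m; assume 𝒫 is nonempty. Let Q : Ω → ℝ be continuous. Then there exist n ≤ m + 1, points ξ₁,…,ξ_n ∈ Ω and weights p₁,…,p_n ≥ 0 with Σ_j p_j = 1 such that the finitely supported measure P* = Σ_j p_j δ_{ξ_j} belongs to 𝒫 and ∫_Ω Q dP* = sup_{P ∈ 𝒫} ∫_Ω Q dP. In words, the worst-case expected value over the moment-based ambiguity set with m moment constraints is attained by a discrete distribution supported on at most m + 1 scenarios. -/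

import Mathlib

open MeasureTheory

/-- Integrals against a finite combination of Dirac masses are weighted sums. -/
theorem integral_sum_ofReal_smul_dirac {Ω ι : Type*} [Fintype ι] [TopologicalSpace Ω]
    [MeasurableSpace Ω] [BorelSpace Ω] (ξ : ι → Ω) (p : ι → ℝ) (hp : ∀ j, 0 ≤ p j)
    {f : Ω → ℝ} (hf : Continuous f) :
    ∫ ω, f ω ∂(∑ j, ENNReal.ofReal (p j) • Measure.dirac (ξ j)) = ∑ j, p j * f (ξ j) := by
  have hfm := hf.stronglyMeasurable
  rw [integral_finsetSum_measure]
  · refine Finset.sum_congr rfl fun j _ => ?_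
    rw [integral_smul_measure, integral_dirac' _ _ hfm, ENNReal.toReal_ofReal (hp j), smul_eq_mul]
  · intro j _
    refine Integrable.smul_measure ?_ ENNReal.ofReal_ne_top
    exact integrable_dirac' hfm (by simp)

/-- In finite dimension, the convex hull of a compact set is compact. -/
theorem isCompact_convexHull_of_isCompact {E : Type*} [NormedAddCommGroup E] [NormedSpace ℝ E]
    [FiniteDimensional ℝ E] {s : Set E} (hs : IsCompact s) : IsCompact (convexHull ℝ s) := by
  rcases s.eq_empty_or_nonempty with rfl | ⟨x₀, hx₀⟩
  · simp
  let N := Module.finrank ℝ E + 1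
  have hc : IsCompact (stdSimplex ℝ (Fin N) ×ˢ Set.univ.pi fun _ : Fin N => s) :=
    (isCompact_stdSimplex ℝ _).prod (isCompact_univ_pi fun _ => hs)
  have hf : Continuous fun q : (Fin N → ℝ) × (Fin N → E) => ∑ j, q.1 j • q.2 j := by fun_prop
  convert! hc.image hf using 1
  refine Set.Subset.antisymm (fun x hx => ?_) ?_
  · obtain ⟨ι, _, z, w, hzs, hind, hw, hw1, hwz⟩ := eq_pos_convex_span_of_mem_convexHull hx
    have hcard : Fintype.card ι ≤ Fintype.card (Fin N) := by
      rw [Fintype.card_fin]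
      exact hind.card_le_finrank_succ.trans (Nat.succ_le_succ (Submodule.finrank_le _))
    obtain ⟨e⟩ := Function.Embedding.nonempty_of_card_le hcard
    have hext : ∀ j, j ∉ Set.range e → Function.extend e w 0 j = 0 := fun j hj =>
      Function.extend_apply' _ _ _ hj
    refine ⟨(Function.extend e w 0, Function.extend e z fun _ => x₀), ⟨⟨fun j => ?_, ?_⟩, ?_⟩, ?_⟩
    · by_cases hj : ∃ i, e i = j
      · obtain ⟨i, rfl⟩ := hj
        simpa [e.injective.extend_apply] using (hw i).le
      · exact (hext j hj).ge
    · rw [← hw1]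
      exact (Fintype.sum_of_injective e e.injective _ _ hext fun i =>
        (e.injective.extend_apply _ _ _).symm).symm
    · intro j _
      by_cases hj : ∃ i, e i = j
      · obtain ⟨i, rfl⟩ := hj
        simpa [e.injective.extend_apply] using hzs ⟨i, rfl⟩
      · simpa [Function.extend_apply' _ _ _ hj] using hx₀
    · rw [← hwz]
      exact (Fintype.sum_of_injective e e.injective _ _ (fun j hj => by simp [hext j hj])
        fun i => by simp [e.injective.extend_apply]).symm
  · rintro _ ⟨q, ⟨⟨hq0, hq1⟩, hqs⟩, rfl⟩
    exact (convex_convexHull ℝ s).sum_mem (fun j _ => hq0 j) hq1 fun j _ =>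
      subset_convexHull ℝ s (hqs j trivial)

/-- The mean of a continuous map on a compact space lies in the convex hull of its range. -/
theorem integral_mem_convexHull_range {Ω E : Type*} [TopologicalSpace Ω] [CompactSpace Ω]
    [MeasurableSpace Ω] [BorelSpace Ω] [NormedAddCommGroup E] [NormedSpace ℝ E]
    [FiniteDimensional ℝ E] {F : Ω → E} (hF : Continuous F) (P : Measure Ω) [IsProbabilityMeasure P]
    (hFi : Integrable F P) :
    ∫ ω, F ω ∂P ∈ convexHull ℝ (Set.range F) :=
  (convex_convexHull ℝ _).integral_mem (isCompact_convexHull_of_isCompact (isCompact_range hF)).isClosed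
    (Filter.Eventually.of_forall fun ω => subset_convexHull ℝ _ ⟨ω, rfl⟩) hFi

/-- If a positive convex combination of affinely independent points maximizes the last coordinate
over a convex set among the points with the same first coordinate, then the first coordinates
are affinely independent as well. -/
theorem affineIndependent_fst_of_isMax {V ι : Type*} [AddCommGroup V] [Module ℝ V] [Fintype ι]
    {K : Set (V × ℝ)} (hK : Convex ℝ K) {z : ι → V × ℝ} (hz : ∀ j, z j ∈ K)
    (hind : AffineIndependent ℝ z) {p : ι → ℝ} (hp : ∀ j, 0 < p j) (hp1 : ∑ j, p j = 1)
    (hmax : ∀ y ∈ K, y.1 = ∑ j, p j • (z j).1 → y.2 ≤ ∑ j, p j * (z j).2) :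
    AffineIndependent ℝ fun j => (z j).1 := by
  classical
  rw [affineIndependent_iff] at hind ⊢
  intro s w hw0 hw1
  refine hind s w hw0 ?_
  set c : ι → ℝ := fun j => if j ∈ s then w j else 0 with hc
  have hc0 : ∑ j, c j = 0 := by simpa [hc] using hw0
  have hc1 : ∑ j, c j • (z j).1 = 0 := by simpa [hc, ite_smul] using hw1
  have hc2 : ∑ j, c j * (z j).2 = ∑ j ∈ s, w j * (z j).2 := by simp [hc, ite_mul]
  have hev : ∀ᶠ ε : ℝ in nhds 0, ∀ j, 0 < p j + ε * c j := by
    rw [Filter.eventually_all]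
    intro j
    have : Continuous fun ε : ℝ => p j + ε * c j := by fun_prop
    exact this.continuousAt.eventually_mem (Ioi_mem_nhds (by simpa using hp j))
  have key : ∀ ε : ℝ, (∀ j, 0 < p j + ε * c j) → ε * ∑ j, c j * (z j).2 ≤ 0 := by
    intro ε hε
    have hmem : ∑ j, (p j + ε * c j) • z j ∈ K :=
      hK.sum_mem (fun j _ => (hε j).le)
        (by rw [Finset.sum_add_distrib, ← Finset.mul_sum, hc0, hp1]; simp) fun j _ => hz j
    have h := hmax _ hmem (by
      simp only [add_smul, mul_smul, Finset.sum_add_distrib]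
      rw [← Finset.smul_sum, Prod.fst_add, Prod.smul_fst, Prod.fst_sum, Prod.fst_sum]
      simp [hc1])
    simp only [Prod.snd_sum, Prod.smul_snd, smul_eq_mul, add_mul, mul_assoc,
      Finset.sum_add_distrib] at h
    rw [← Finset.mul_sum] at h
    linarith
  obtain ⟨δ, hδ, hball⟩ := Metric.eventually_nhds_iff.1 hev
  have h1 := key (δ / 2) (hball (by rw [dist_zero_right, Real.norm_eq_abs, abs_of_pos] <;> linarith))
  have h2 := key (-(δ / 2))
    (hball (by rw [dist_zero_right, norm_neg, Real.norm_eq_abs, abs_of_pos] <;> linarith))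
  have hd : ∑ j, c j * (z j).2 = 0 := by
    have : δ / 2 * ∑ j, c j * (z j).2 = 0 := by linarith
    exact (mul_eq_zero.1 this).resolve_left (by positivity)
  ext1
  · simpa [Prod.fst_sum] using hw1
  · simpa [Prod.snd_sum] using hc2.symm.trans hd

/-- The worst-case expected value over the moment-based ambiguity set with m moment
constraints is attained by a discrete distribution supported on at most m + 1 scenarios. -/
theorem stmt4 {Ω : Type*} [MetricSpace Ω] [CompactSpace Ω]
    [MeasurableSpace Ω] [BorelSpace Ω]
    (m : ℕ) (ψ : Fin m → Ω → ℝ) (hψ : ∀ i, Continuous (ψ i)) (γ : Fin m → ℝ)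
    (Pamb : Set (Measure Ω))
    (hPamb : Pamb = {P : Measure Ω | IsProbabilityMeasure P ∧ ∀ i, ∫ ω, ψ i ω ∂P ≤ γ i})
    (hne : Pamb.Nonempty)
    (Q : Ω → ℝ) (hQ : Continuous Q) :
    ∃ (n : ℕ), n ≤ m + 1 ∧ ∃ (ξ : Fin n → Ω) (p : Fin n → ℝ),
      (∀ j, 0 ≤ p j) ∧ ∑ j, p j = 1 ∧
      (∑ j, ENNReal.ofReal (p j) • Measure.dirac (ξ j)) ∈ Pamb ∧
      ∫ ω, Q ω ∂(∑ j, ENNReal.ofReal (p j) • Measure.dirac (ξ j)) =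
        sSup ((fun P : Measure Ω => ∫ ω, Q ω ∂P) '' Pamb) := by
  subst hPamb
  set F : Ω → (Fin m → ℝ) × ℝ := fun ω => (fun i => ψ i ω, Q ω) with hFdef
  have hF : Continuous F := by fun_prop
  have hint : ∀ {E : Type} [NormedAddCommGroup E] [SecondCountableTopology E] {f : Ω → E},
      Continuous f → ∀ P : Measure Ω, IsProbabilityMeasure P → Integrable f P :=
    fun hf P _ => hf.integrable_of_hasCompactSupport (HasCompactSupport.of_compactSpace _)
  set K := convexHull ℝ (Set.range F)
  have hmean : ∀ P : Measure Ω, IsProbabilityMeasure P →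
      ((fun i => ∫ ω, ψ i ω ∂P), ∫ ω, Q ω ∂P) ∈ K := by
    intro P hP
    have h := integral_mem_convexHull_range hF P (hint hF P hP)
    rw [integral_pair (hint (by fun_prop) P hP) (hint hQ P hP)] at h
    convert h using 2
    ext i
    exact (eval_integral (fun i => hint (hψ i) P hP) i).symm
  have hcomp : IsCompact (K ∩ {y | y.1 ≤ γ}) :=
    (isCompact_convexHull_of_isCompact (isCompact_range hF)).inter_right (isClosed_le continuous_fst continuous_const)
  obtain ⟨y, ⟨hyK, hyγ⟩, hymax⟩ := hcomp.exists_isMaxOn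
    (by obtain ⟨P, hP, hPγ⟩ := hne; exact ⟨_, hmean P hP, hPγ⟩)
    (continuous_snd (X := Fin m → ℝ) (Y := ℝ)).continuousOn
  obtain ⟨ι, hι, z, p, hzF, hind, hp, hp1, hpz⟩ := eq_pos_convex_span_of_mem_convexHull hyK
  have hy1 : y.1 = ∑ j, p j • (z j).1 := by rw [← hpz]; simp [Prod.fst_sum]
  have hy2 : y.2 = ∑ j, p j * (z j).2 := by rw [← hpz]; simp [Prod.snd_sum]
  have hind' := affineIndependent_fst_of_isMax (convex_convexHull ℝ (Set.range F))
    (fun j => subset_convexHull ℝ _ (hzF ⟨j, rfl⟩)) hind hp hp1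
    (fun x hx hx1 => hy2 ▸ hymax ⟨hx, by rw [← hy1] at hx1; simpa [hx1] using hyγ⟩)
  have hcard : Fintype.card ι ≤ m + 1 := by
    refine hind'.card_le_finrank_succ.trans (Nat.succ_le_succ ?_)
    simpa using Submodule.finrank_le (vectorSpan ℝ (Set.range fun j => (z j).1))
  choose ξ hξ using fun j => hzF ⟨j, rfl⟩
  let e := (Fintype.equivFin ι).symm
  have hp0 : ∀ j, 0 ≤ p (e j) := fun j => (hp _).le
  have hsum : ∑ j, p (e j) = 1 := (e.sum_comp p).trans hp1
  have hψ' : ∀ i, ∫ ω, ψ i ω ∂(∑ j, ENNReal.ofReal (p (e j)) • Measure.dirac (ξ (e j))) = y.1 i := by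
    intro i
    rw [integral_sum_ofReal_smul_dirac _ _ hp0 (hψ i), e.sum_comp fun j => p j * ψ i (ξ j), hy1]
    simp [Finset.sum_apply, ← hξ, hFdef]
  have hQ' : ∫ ω, Q ω ∂(∑ j, ENNReal.ofReal (p (e j)) • Measure.dirac (ξ (e j))) = y.2 := by
    rw [integral_sum_ofReal_smul_dirac _ _ hp0 hQ, e.sum_comp fun j => p j * Q (ξ j), hy2]
    simp [← hξ, hFdef]
  have hmem : (∑ j, ENNReal.ofReal (p (e j)) • Measure.dirac (ξ (e j))) ∈
      {P : Measure Ω | IsProbabilityMeasure P ∧ ∀ i, ∫ ω, ψ i ω ∂P ≤ γ i} := by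
    refine ⟨⟨?_⟩, fun i => (hψ' i).trans_le (hyγ i)⟩
    simp [← ENNReal.ofReal_sum_of_nonneg fun j _ => hp0 j, hsum]
  refine ⟨Fintype.card ι, hcard, ξ ∘ e, p ∘ e, hp0, hsum, hmem, ?_⟩
  symm
  apply IsGreatest.csSup_eq
  refine ⟨⟨_, hmem, rfl⟩, ?_⟩
  rintro _ ⟨P, ⟨hP, hPγ⟩, rfl⟩
  have hle : ∫ ω, Q ω ∂P ≤ y.2 := isMaxOn_iff.1 hymax _ ⟨hmean P hP, hPγ⟩
  exact hle.trans hQ'.ge
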